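/- arXiv:1801.09140 — 4 statements merged into one kernel-verified Lean document; each statement's English description precedes it below -/
import Mathlib

section
/- Let r ≥ 2 and m ≥ 1, and let E = {e_1, …, e_r, a_1, …, a_m} be the vectors of the configuration E_{r,m}. Let ≺ be a linear order on E such that the ≺-maximum and ≺-minimum elements both belong to {e_1, …, e_r}, and such that either e_r ≺ a_m ≺ ⋯ ≺ a_1 or a_1 ≺ ⋯ ≺ a_m ≺ e_r. Then there exists a linear functional ψ on ℝ^r such that for all distinct u, w ∈ E: u ≺ w if and only if ψ(u)/π(u) < ψ(w)/π(w). -/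
open Finset

/-- A real function bounded above by `c` and strictly increasing on a finite subset `s` of a
strict total order extends from `s` to any finite set `s ∪ t` with the same properties. -/
lemma exists_strictMono_extension {α : Type*} [DecidableEq α] (R : α → α → Prop)
    [IsStrictTotalOrder α R] (s t : Finset α) (f : α → ℝ) (c : ℝ) (hc : ∀ a ∈ s, f a < c)
    (hf : ∀ a ∈ s, ∀ b ∈ s, R a b → f a < f b) :
    ∃ g : α → ℝ, (∀ a ∈ s, g a = f a) ∧ (∀ a ∈ s ∪ t, g a < c) ∧
      ∀ a ∈ s ∪ t, ∀ b ∈ s ∪ t, R a b → g a < g b := by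
  classical
  induction t using Finset.induction_on with
  | empty => exact ⟨f, fun _ _ => rfl, by simpa using hc, by simpa using hf⟩
  | insert x t _ ih =>
    obtain ⟨g, hgf, hgc, hg⟩ := ih
    rw [Finset.union_insert]
    by_cases hx : x ∈ s ∪ t
    · rw [Finset.insert_eq_of_mem hx]
      exact ⟨g, hgf, hgc, hg⟩
    · obtain ⟨y, hy₁, hy₂⟩ := Order.exists_between_finsets
        (((s ∪ t).filter (R · x)).image g) (insert c (((s ∪ t).filter (R x ·)).image g)) (by
          intro p hp q hq
          obtain ⟨a, ha, rfl⟩ := Finset.mem_image.1 hp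
          rw [Finset.mem_filter] at ha
          rcases Finset.mem_insert.1 hq with rfl | hq
          · exact hgc a ha.1
          · obtain ⟨b, hb, rfl⟩ := Finset.mem_image.1 hq
            rw [Finset.mem_filter] at hb
            exact hg a ha.1 b hb.1 (_root_.trans ha.2 hb.2))
      have hne : ∀ a ∈ s ∪ t, a ≠ x := fun a ha h => hx (h ▸ ha)
      refine ⟨Function.update g x y, fun a ha => ?_, fun a ha => ?_, fun a ha b hb hab => ?_⟩
      · rw [Function.update_of_ne (hne a (Finset.mem_union_left _ ha)), hgf a ha]
      · rcases Finset.mem_insert.1 ha with rfl | ha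
        · simpa using hy₂ c (Finset.mem_insert_self _ _)
        · rw [Function.update_of_ne (hne a ha)]
          exact hgc a ha
      · rcases Finset.mem_insert.1 ha with rfl | ha' <;>
          rcases Finset.mem_insert.1 hb with rfl | hb'
        · exact absurd hab (irrefl _)
        · rw [Function.update_self, Function.update_of_ne (hne b hb')]
          exact hy₂ _ (Finset.mem_insert_of_mem (Finset.mem_image_of_mem g
            (Finset.mem_filter.2 ⟨hb', hab⟩)))
        · rw [Function.update_self, Function.update_of_ne (hne a ha')]
          exact hy₁ _ (Finset.mem_image_of_mem g (Finset.mem_filter.2 ⟨ha', hab⟩))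
        · rw [Function.update_of_ne (hne a ha'), Function.update_of_ne (hne b hb')]
          exact hg a ha' b hb' hab

/-- If the maximum of the order is a basis vector `e_M` and `e_ℓ ≺ a_m ≺ ⋯ ≺ a_1`, then there are
increasing values with `e_ℓ ↦ 0`, `a_i ↦ 1 / (i + r)` and the values on the basis summing to `1`. -/
lemma exists_strictMono_sum_eq_one {r m : ℕ}
    (R : Fin r ⊕ Fin m → Fin r ⊕ Fin m → Prop) [IsStrictTotalOrder (Fin r ⊕ Fin m) R]
    (ℓ M : Fin r) (hM : ∀ u, u ≠ Sum.inl M → R u (Sum.inl M)) (hℓM : ℓ ≠ M)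
    (hlow : ∀ i : Fin m, R (Sum.inl ℓ) (Sum.inr i))
    (hdec : ∀ i i' : Fin m, i < i' → R (Sum.inr i') (Sum.inr i)) :
    ∃ F : Fin r ⊕ Fin m → ℝ, F (Sum.inl ℓ) = 0 ∧
      (∀ i : Fin m, F (Sum.inr i) = 1 / ((i : ℝ) + 1 + r)) ∧
      ∑ k, F (Sum.inl k) = 1 ∧ ∀ u w, R u w → F u < F w := by
  have hr : (0 : ℝ) < r := by exact_mod_cast ℓ.pos
  obtain ⟨g, hgf, hgc, hg⟩ := exists_strictMono_extension R
    (insert (Sum.inl ℓ) (Finset.univ.image Sum.inr)) (Finset.univ.erase (Sum.inl M))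
    (Sum.elim (fun _ => 0) fun i : Fin m => 1 / ((i : ℝ) + 1 + r)) (1 / r)
    (by
      rintro (a | i) -
      · simpa using hr
      · exact one_div_lt_one_div_of_lt hr (by linarith [(i : ℕ).cast_nonneg (α := ℝ)]))
    (by
      rintro (a | i) ha (b | j) hb hab
      · simp only [Finset.mem_insert, Finset.mem_image, Sum.inl.injEq, reduceCtorEq, and_false,
          exists_false, or_false] at ha hb
        subst ha hb
        exact absurd hab (irrefl _)
      · simp only [Sum.elim_inl, Sum.elim_inr]
        positivity
      · simp only [Finset.mem_insert, Finset.mem_image, Sum.inl.injEq, reduceCtorEq, and_false,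
          exists_false, or_false] at hb
        subst hb
        exact absurd hab (asymm (hlow i))
      · have hji : j < i := by
          rcases lt_trichotomy i j with h | rfl | h
          · exact absurd hab (asymm (hdec i j h))
          · exact absurd hab (irrefl _)
          · exact h
        have : (j : ℝ) < i := by exact_mod_cast hji
        exact one_div_lt_one_div_of_lt (by positivity) (by linarith))
  have hmem : ∀ u : Fin r ⊕ Fin m, u ≠ Sum.inl M →
      u ∈ insert (Sum.inl ℓ) (Finset.univ.image Sum.inr) ∪ Finset.univ.erase (Sum.inl M) :=
    fun u hu => Finset.mem_union_right _ (Finset.mem_erase.2 ⟨hu, Finset.mem_univ _⟩)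
  set S : ℝ := ∑ k ∈ Finset.univ.erase M, g (Sum.inl k) with hS
  have hgℓ : g (Sum.inl ℓ) = 0 := hgf _ (Finset.mem_insert_self _ _)
  have hS' : S ≤ (r - 2) * (1 / r) := by
    have hℓ : ℓ ∈ Finset.univ.erase M := by simpa using hℓM
    rw [hS, ← Finset.add_sum_erase _ _ hℓ, hgℓ, zero_add]
    refine (Finset.sum_le_card_nsmul _ _ (1 / (r : ℝ)) fun k hk => ?_).trans_eq ?_
    · refine (hgc _ (hmem _ ?_)).le
      simp only [Finset.mem_erase] at hk
      simpa using hk.2.1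
    · have h2 : 2 ≤ r := by have := ℓ.2; have := M.2; have := Fin.val_ne_of_ne hℓM; omega
      rw [Finset.card_erase_of_mem hℓ, Finset.card_erase_of_mem (Finset.mem_univ M),
        Finset.card_univ, Fintype.card_fin, nsmul_eq_mul, Nat.sub_sub, Nat.cast_sub h2]
      norm_num
  have hmax : 1 / (r : ℝ) < 1 - S := by
    have h1 : (r : ℝ) * (1 / r) = 1 := by field_simp
    have h2 : 0 < 1 / (r : ℝ) := by positivity
    linarith
  refine ⟨Function.update g (Sum.inl M) (1 - S), ?_, fun i => ?_, ?_, fun u w huw => ?_⟩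
  · rw [Function.update_of_ne (by simpa using hℓM), hgℓ]
  · rw [Function.update_of_ne (by simp), hgf _ (by simp), Sum.elim_inr]
  · rw [← Finset.add_sum_erase _ _ (Finset.mem_univ M), Function.update_self,
      Finset.sum_congr rfl fun k hk => Function.update_of_ne
        (show (Sum.inl k : Fin r ⊕ Fin m) ≠ Sum.inl M by simpa using hk) (1 - S) g]
    linarith
  · have hu : u ≠ Sum.inl M := by
      rintro rfl
      rcases eq_or_ne w (Sum.inl M) with rfl | hw
      · exact irrefl _ huw
      · exact asymm huw (hM w hw)
    rw [Function.update_of_ne hu]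
    rcases eq_or_ne w (Sum.inl M) with rfl | hw
    · rw [Function.update_self]
      exact (hgc u (hmem u hu)).trans hmax
    · rw [Function.update_of_ne hw]
      exact hg u (hmem u hu) w (hmem w hw) huw

lemma exists_functional_of_decreasing {r m : ℕ} (hm : 1 ≤ m)
    (v : Fin r ⊕ Fin m → Fin r → ℝ) (ℓ M : Fin r) (hℓ : (ℓ : ℕ) = r - 1)
    (hv1 : ∀ j : Fin r, v (Sum.inl j) = Pi.single j 1)
    (hv2 : ∀ i : Fin m, v (Sum.inr i)
      = fun k : Fin r => (if (k : ℕ) = r - 1 then ((i : ℕ) + 1 : ℝ) else 0) + 1)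
    (π : (Fin r → ℝ) →ₗ[ℝ] ℝ) (hπ : ∀ x, π x = ∑ k, x k)
    (R : Fin r ⊕ Fin m → Fin r ⊕ Fin m → Prop) [IsStrictTotalOrder (Fin r ⊕ Fin m) R]
    (hM : ∀ u, u ≠ Sum.inl M → R u (Sum.inl M))
    (hlast : R (Sum.inl ℓ) (Sum.inr ⟨m - 1, by omega⟩))
    (hdec : ∀ i i' : Fin m, i < i' → R (Sum.inr i') (Sum.inr i)) :
    ∃ ψ : (Fin r → ℝ) →ₗ[ℝ] ℝ, ∀ u w : Fin r ⊕ Fin m,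
      R u w → ψ (v u) / π (v u) < ψ (v w) / π (v w) := by
  have hℓM : ℓ ≠ M := by
    rintro rfl
    exact asymm hlast (hM _ (by simp))
  have hlow : ∀ i : Fin m, R (Sum.inl ℓ) (Sum.inr i) := fun i => by
    rcases eq_or_ne i ⟨m - 1, by omega⟩ with rfl | hi
    · exact hlast
    · refine _root_.trans hlast (hdec _ _ (Fin.lt_def.2 ?_))
      have := Fin.val_ne_of_ne hi
      have := i.2
      simp only at *
      omega
  obtain ⟨F, hF0, hFa, hFsum, hF⟩ := exists_strictMono_sum_eq_one R ℓ M hM hℓM hlow hdec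
  have hiff : ∀ k : Fin r, (k : ℕ) = r - 1 ↔ k = ℓ := fun k => by rw [Fin.ext_iff, hℓ]
  refine ⟨Fintype.linearCombination ℝ fun k => F (Sum.inl k), ?_⟩
  have hval : ∀ u, Fintype.linearCombination ℝ (fun k => F (Sum.inl k)) (v u) / π (v u) = F u := by
    rintro (j | i)
    · simp [hv1, hπ, Fintype.linearCombination_apply, Pi.single_apply]
    · simp [hv2, hπ, Fintype.linearCombination_apply, hiff, add_mul, Finset.sum_add_distrib,
        hF0, hFa, hFsum]
  intro u w huw
  rw [hval, hval]
  exact hF u w huw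

/-- For the configuration `E_{r,m}` (`r ≥ 2`, `m ≥ 1`), any linear order
`≺` on the vectors whose maximum and minimum are basis vectors and in which the `a_i` and
`e_r` appear consecutively as `e_r ≺ a_m ≺ ⋯ ≺ a_1` or `a_1 ≺ ⋯ ≺ a_m ≺ e_r` is realized by
a linear functional: `u ≺ w ↔ ψ(u)/π(u) < ψ(w)/π(w)`. -/
theorem statement10 (r m : ℕ) (hr : 2 ≤ r) (hm : 1 ≤ m)
    (v : Fin r ⊕ Fin m → Fin r → ℝ)
    (hv1 : ∀ j : Fin r, v (Sum.inl j) = Pi.single j 1)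
    (hv2 : ∀ i : Fin m, v (Sum.inr i)
      = fun k : Fin r => (if (k : ℕ) = r - 1 then ((i : ℕ) + 1 : ℝ) else 0) + 1)
    (π : (Fin r → ℝ) →ₗ[ℝ] ℝ) (hπ : ∀ x, π x = ∑ k, x k)
    (prec : Fin r ⊕ Fin m → Fin r ⊕ Fin m → Prop)
    (hord : IsStrictTotalOrder (Fin r ⊕ Fin m) prec)
    (hmin : ∃ j : Fin r, ∀ u, u ≠ Sum.inl j → prec (Sum.inl j) u)
    (hmax : ∃ j : Fin r, ∀ u, u ≠ Sum.inl j → prec u (Sum.inl j))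
    (hchain :
      (prec (Sum.inl ⟨r - 1, by omega⟩) (Sum.inr ⟨m - 1, by omega⟩) ∧
        ∀ i i' : Fin m, i < i' → prec (Sum.inr i') (Sum.inr i)) ∨
      ((∀ i i' : Fin m, i < i' → prec (Sum.inr i) (Sum.inr i')) ∧
        prec (Sum.inr ⟨m - 1, by omega⟩) (Sum.inl ⟨r - 1, by omega⟩))) :
    ∃ ψ : (Fin r → ℝ) →ₗ[ℝ] ℝ, ∀ u w : Fin r ⊕ Fin m, u ≠ w →
      (prec u w ↔ ψ (v u) / π (v u) < ψ (v w) / π (v w)) := by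
  suffices h : ∃ ψ : (Fin r → ℝ) →ₗ[ℝ] ℝ, ∀ u w : Fin r ⊕ Fin m,
      prec u w → ψ (v u) / π (v u) < ψ (v w) / π (v w) by
    obtain ⟨ψ, hψ⟩ := h
    refine ⟨ψ, fun u w huw => ⟨hψ u w, fun hlt => ?_⟩⟩
    rcases trichotomous_of prec u w with h | h | h
    · exact h
    · exact absurd h huw
    · exact absurd hlt (hψ w u h).asymm
  rcases hchain with ⟨hlast, hdec⟩ | ⟨hinc, hlast⟩
  · obtain ⟨M, hM⟩ := hmax
    exact exists_functional_of_decreasing hm v _ M rfl hv1 hv2 π hπ prec hM hlast hdec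
  · obtain ⟨M, hM⟩ := hmin
    obtain ⟨ψ, hψ⟩ := exists_functional_of_decreasing hm v _ M rfl hv1 hv2 π hπ
      (Function.swap prec) hM hlast hinc
    refine ⟨-ψ, fun u w huw => ?_⟩
    simpa [neg_div] using hψ w u huw
end

section
/- Let r ≥ 2 and m ≥ 1, and let E = {e_1, …, e_r, a_1, …, a_m} be the vectors of the configuration E_{r,m}. Then the number of monotone path orders of E_{r,m}, i.e., linear orders ≺ on E such that for every u ∈ E there exists a linear functional φ on ℝ^r with φ(u) = 0, φ(w) < 0 for all w ≺ u, and φ(w) > 0 for all w with u ≺ w, equals 2 · (r−1)! · binom(m+r−1, m+1). -/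
open Finset

section Counting

/-- The chain positions are the increasing enumeration of the complement of the positions `f`. -/
noncomputable def shufflePosition {n q : ℕ} (f : Fin q ↪ Fin (n + q)) : Fin n ⊕ Fin q → Fin (n + q) :=
  Sum.elim ((univ.map f)ᶜ.orderEmbOfFin (k := n) (by simp [card_compl])) f

theorem shufflePosition_bijective {n q : ℕ} (f : Fin q ↪ Fin (n + q)) :
    Function.Bijective (shufflePosition f) := by
  rw [Fintype.bijective_iff_injective_and_card]
  refine ⟨?_, by simp⟩
  refine Function.Injective.sumElim (RelEmbedding.injective _) f.injective ?_
  intro i j h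
  have := Finset.orderEmbOfFin_mem (univ.map f)ᶜ (k := n) (by simp [card_compl]) i
  rw [h] at this
  simp at this

theorem shufflePosition_inl_lt {n q : ℕ} (f : Fin q ↪ Fin (n + q)) {i k : Fin n} (h : i < k) :
    shufflePosition f (Sum.inl i) < shufflePosition f (Sum.inl k) := by
  simpa [shufflePosition] using h

theorem shufflePosition_unique {n q : ℕ} (p : Fin n ⊕ Fin q ≃ Fin (n + q))
    (hp : StrictMono fun i => p (Sum.inl i)) :
    shufflePosition ⟨fun j => p (Sum.inr j), p.injective.comp Sum.inr_injective⟩ = p := by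
  funext x
  rcases x with i | j
  · have := Finset.orderEmbOfFin_unique
      (s := (univ.map (⟨fun j => p (Sum.inr j), p.injective.comp Sum.inr_injective⟩ :
        Fin q ↪ Fin (n + q)))ᶜ) (k := n) (by simp [card_compl])
      (f := fun i => p (Sum.inl i)) (by intro x; simp) hp
    exact (congrFun this i).symm
  · rfl

theorem eq_of_lt_iff_lt {α : Type*} {N : ℕ} (p p' : α ≃ Fin N)
    (h : ∀ x y, p x < p y ↔ p' x < p' y) : p = p' := by
  have e : ∀ x y, p x ≤ p y ↔ p' x ≤ p' y := fun x y => by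
    rw [← not_lt, ← not_lt, h]
  let o : Fin N ≃o Fin N := ⟨p.symm.trans p', by intro a b; simp [← e]⟩
  have ho : o = OrderIso.refl _ := Subsingleton.elim _ _
  ext x
  have : o (p x) = p x := by rw [ho]; rfl
  have h2 : o (p x) = p' x := by simp [o]
  rw [← h2, this]

theorem exists_equiv_fin_of_isStrictTotalOrder {α : Type*} [Fintype α] {N : ℕ}
    (hN : Fintype.card α = N) (prec : α → α → Prop) (h : IsStrictTotalOrder α prec) :
    ∃ p : α ≃ Fin N, ∀ x y, prec x y ↔ p x < p y := by
  classical
  let _ : LinearOrder α := linearOrderOfSTO prec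
  exact ⟨(Fintype.orderIsoFinOfCardEq α hN).symm.toEquiv, fun x y =>
    ((Fintype.orderIsoFinOfCardEq α hN).symm.lt_iff_lt (x := x) (y := y)).symm⟩

theorem ncard_embedding_zero_mem_range (n q : ℕ) :
    {f : Fin q ↪ Fin (n + 1 + q) | ∃ j, ((f j : Fin (n + 1 + q)) : ℕ) = 0}.ncard
      = q.factorial * (n + q).choose (n + 1) := by
  classical
  set S := {f : Fin q ↪ Fin (n + 1 + q) | ∃ j, ((f j : Fin (n + 1 + q)) : ℕ) = 0}
  have h1 : S.ncard + Sᶜ.ncard = Nat.card (Fin q ↪ Fin (n + 1 + q)) := Set.ncard_add_ncard_compl S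
  have h2 : Sᶜ.ncard = (n + q).descFactorial q := by
    have e : (Sᶜ : Set (Fin q ↪ Fin (n + 1 + q))) ≃
        (Fin q ↪ {x : Fin (n + 1 + q) // (x : ℕ) ≠ 0}) :=
      { toFun := fun f => ⟨fun j => ⟨f.1 j, fun h => f.2 ⟨j, h⟩⟩,
          fun a b h => f.1.injective (congrArg Subtype.val h)⟩
        invFun := fun f => ⟨f.trans (Function.Embedding.subtype _), by
          rintro ⟨j, hj⟩; exact (f j).2 hj⟩
        left_inv := fun f => by ext; rfl
        right_inv := fun f => by ext; rfl }
    rw [← Nat.card_coe_set_eq, Nat.card_congr e, Nat.card_eq_fintype_card,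
      Fintype.card_embedding_eq, Fintype.card_fin]
    congr 1
    have : Fintype.card {x : Fin (n + 1 + q) // (x : ℕ) = 0} = 1 :=
      Fintype.card_eq_one_iff.2 ⟨⟨⟨0, by omega⟩, rfl⟩, fun y => Subtype.ext (Fin.ext y.2)⟩
    rw [Fintype.card_subtype_compl, this, Fintype.card_fin]
    omega
  rw [h2, Nat.card_eq_fintype_card, Fintype.card_embedding_eq, Fintype.card_fin, Fintype.card_fin,
    Nat.descFactorial_eq_factorial_mul_choose, Nat.descFactorial_eq_factorial_mul_choose] at h1
  have h3 : (n + 1 + q).choose q = (n + q).choose q + (n + q).choose (n + 1) := by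
    rw [← Nat.choose_symm_add, show n + 1 + q = n + q + 1 by ring, Nat.choose_succ_succ,
      Nat.choose_symm_add]
  rw [h3, mul_add] at h1
  omega

/-- Linear extensions of a chain `c` and free elements `e` whose least element is free. -/
theorem ncard_shuffle {α : Type*} [Fintype α] (n q : ℕ) (c : Fin (n + 1) → α) (e : Fin q → α)
    (hb : Function.Bijective (Sum.elim c e)) :
    {prec : α → α → Prop | IsStrictTotalOrder α prec ∧ (∀ i k, i < k → prec (c i) (c k)) ∧
      ∃ j, prec (e j) (c 0)}.ncard = q.factorial * (n + q).choose (n + 1) := by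
  let g := Equiv.ofBijective _ hb
  have hgc : ∀ i, g.symm (c i) = Sum.inl i := fun i => by
    rw [Equiv.symm_apply_eq]; rfl
  have hge : ∀ i, g.symm (e i) = Sum.inr i := fun i => by
    rw [Equiv.symm_apply_eq]; rfl
  let P (f : Fin q ↪ Fin (n + 1 + q)) : α ≃ Fin (n + 1 + q) :=
    g.symm.trans (Equiv.ofBijective _ (shufflePosition_bijective f))
  have hPe : ∀ f j, P f (e j) = f j := fun f j => by
    simp [P, hge, shufflePosition]
  have hPc : ∀ f i k, i < k → P f (c i) < P f (c k) := fun f i k h => by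
    simpa [P, hgc] using shufflePosition_inl_lt f h
  rw [← ncard_embedding_zero_mem_range, ← Set.ncard_image_of_injective (f := fun f x y => P f x < P f y)]
  · congr 1
    ext prec
    constructor
    · rintro ⟨h, hc, j, hj⟩
      obtain ⟨p, hp⟩ := exists_equiv_fin_of_isStrictTotalOrder (N := n + 1 + q)
        (by rw [← Fintype.card_congr g]; simp) prec h
      have hu := shufflePosition_unique (g.trans p) (fun i k hik => (hp _ _).1 (hc i k hik))
      have hP : P ⟨fun j => p (e j), p.injective.comp (hb.1.comp Sum.inr_injective)⟩ = p := Equiv.ext fun x => by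
        refine (congrFun hu (g.symm x)).trans ?_
        simp
      refine ⟨⟨fun j => p (e j), p.injective.comp (hb.1.comp Sum.inr_injective)⟩, ?_, ?_⟩
      rotate_left
      · funext x y
        simp only [hP, hp]
      · obtain ⟨x, hx⟩ := p.surjective ⟨0, by omega⟩
        obtain ⟨y, rfl⟩ := g.surjective x
        rcases y with i | j'
        · exfalso
          change p (c i) = _ at hx
          rw [hp] at hj
          rcases (Fin.zero_le i).eq_or_lt with h0 | h0
          · rw [h0, hx] at hj
            exact absurd hj (by simp)
          · have := (hp _ _).1 (hc 0 i h0)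
            rw [hx] at this
            exact absurd this (by simp)
        · exact ⟨j', congrArg Fin.val hx⟩
    · rintro ⟨f, ⟨j, hj⟩, rfl⟩
      refine ⟨?_, fun i k h => hPc f i k h, j, ?_⟩
      · exact { trichotomous := fun x y hxy hyx =>
                  (P f).injective (le_antisymm (not_lt.1 hyx) (not_lt.1 hxy))
                irrefl := fun x => lt_irrefl _
                trans := fun x y z => lt_trans }
      · have hne : P f (e j) ≠ P f (c 0) := fun h => by
          have := congrArg g.symm ((P f).injective h)
          rw [hgc, hge] at this
          cases this
        rw [Ne, Fin.ext_iff] at hne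
        change P f (e j) < P f (c 0)
        rw [hPe] at hne ⊢
        rw [Fin.lt_def]
        omega
  · intro f f' h
    have := eq_of_lt_iff_lt (P f) (P f') (fun x y => by
      have := congrFun (congrFun h x) y
      exact this.to_iff)
    ext j
    rw [← hPe f, ← hPe f', this]

end Counting

section Geometry

/-- The linear orders on `E` realised by sweeping functionals. -/
def IsMonotonePathOrder {α V : Type*} [AddCommGroup V] [Module ℝ V] (v : α → V)
    (prec : α → α → Prop) : Prop :=
  IsStrictTotalOrder α prec ∧ ∀ u, ∃ φ : V →ₗ[ℝ] ℝ,
    φ (v u) = 0 ∧ (∀ w, prec w u → φ (v w) < 0) ∧ (∀ w, prec u w → 0 < φ (v w))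

theorem IsMonotonePathOrder.swap {α V : Type*} [AddCommGroup V] [Module ℝ V] {v : α → V}
    {prec : α → α → Prop} (h : IsMonotonePathOrder v prec) :
    IsMonotonePathOrder v (Function.swap prec) := by
  obtain ⟨h1, h2⟩ := h
  refine ⟨inferInstance, fun u => ?_⟩
  obtain ⟨φ, h0, hl, hg⟩ := h2 u
  exact ⟨-φ, by simp [h0], fun w hw => by simpa using hg w hw, fun w hw => by simpa using hl w hw⟩

/-- The orders in which `a_1 ≺ ⋯ ≺ a_m ≺ e_r` and some other `e_j` precedes `a_1`. -/
def IsChainShuffle {q m : ℕ} (prec : Fin (q + 1) ⊕ Fin (m + 1) → Fin (q + 1) ⊕ Fin (m + 1) → Prop) :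
    Prop :=
  IsStrictTotalOrder _ prec ∧ (∀ i k, i < k → prec (Sum.inr i) (Sum.inr k)) ∧
    (∀ i, prec (Sum.inr i) (Sum.inl (Fin.last q))) ∧
    ∃ j : Fin q, prec (Sum.inl j.castSucc) (Sum.inr 0)

theorem ncard_isChainShuffle (q m : ℕ) :
    {prec | IsChainShuffle (q := q) (m := m) prec}.ncard
      = q.factorial * (m + 1 + q).choose (m + 1 + 1) := by
  let c : Fin (m + 1 + 1) → Fin (q + 1) ⊕ Fin (m + 1) :=
    Fin.snoc (α := fun _ => Fin (q + 1) ⊕ Fin (m + 1)) Sum.inr (Sum.inl (Fin.last q))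
  have hcs : ∀ i : Fin (m + 1), c i.castSucc = Sum.inr i := fun i => Fin.snoc_castSucc ..
  have hcl : c (Fin.last _) = Sum.inl (Fin.last q) := Fin.snoc_last ..
  rw [← ncard_shuffle (m + 1) q c (fun j => Sum.inl j.castSucc)]
  · congr 1
    ext prec
    refine and_congr_right fun _ => ?_
    rw [← and_assoc]
    refine and_congr ⟨fun h i k hik => ?_, fun h => ⟨fun i k hik => ?_, fun i => ?_⟩⟩ ?_
    · induction k using Fin.lastCases with
      | last =>
        induction i using Fin.lastCases with
        | last => exact absurd hik (lt_irrefl _)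
        | cast i => rw [hcs, hcl]; exact h.2 i
      | cast k =>
        induction i using Fin.lastCases with
        | last => exact absurd hik (Fin.castSucc_lt_last k).not_gt
        | cast i => rw [hcs, hcs]; exact h.1 i k (by simpa using hik)
    · rw [← hcs, ← hcs]; exact h _ _ (by simpa using hik)
    · rw [← hcs, ← hcl]; exact h _ _ (Fin.castSucc_lt_last i)
    · have : c 0 = Sum.inr 0 := hcs 0
      rw [this]
  · rw [Fintype.bijective_iff_surjective_and_card]
    constructor
    · rintro (j | i)
      · induction j using Fin.lastCases with
        | last => exact ⟨Sum.inl (Fin.last _), hcl⟩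
        | cast j => exact ⟨Sum.inr j, rfl⟩
      · exact ⟨Sum.inl i.castSucc, hcs i⟩
    · simp; omega

theorem exists_threshold {m : ℕ} (P : Fin m → Prop) (hP : ∀ i k, i < k → P k → P i) :
    ∃ n : ℕ, ∀ k, P k ↔ (k : ℕ) < n := by
  classical
  by_cases h : ∃ n : ℕ, ∃ hn : n < m, ¬ P ⟨n, hn⟩
  · refine ⟨Nat.find h, fun k => ⟨fun hk => ?_, fun hk => ?_⟩⟩
    · obtain ⟨hn, hf⟩ := Nat.find_spec h
      by_contra! hle
      rcases hle.eq_or_lt with he | hl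
      · exact hf (by simpa [he] using hk)
      · exact hf (hP ⟨_, hn⟩ k hl hk)
    · by_contra hk'
      exact Nat.find_min h hk ⟨k.2, hk'⟩
  · push Not at h
    exact ⟨m, fun k => ⟨fun _ => k.2, fun _ => h k k.2⟩⟩

theorem exists_signed_neg_sum {α : Type*} {q : ℕ} {prec : α → α → Prop}
    (hs : IsStrictTotalOrder α prec) (e : Fin q → α) (u : α) (j₀ : Fin q)
    (hj : prec (e j₀) u) :
    ∃ x : Fin q → ℝ, ∑ j, x j < 0 ∧ (∀ j, e j = u → x j = 0) ∧ (∀ j, prec (e j) u → x j < 0) ∧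
      ∀ j, prec u (e j) → 0 < x j := by
  classical
  have has : ∀ a b, prec a b → ¬ prec b a := fun a b h h' => hs.irrefl a (hs.trans _ _ _ h h')
  refine ⟨fun j => (if prec (e j) u then -1 else if prec u (e j) then 1 else 0)
    + if j = j₀ then -(q : ℝ) else 0, ?_, ?_, ?_, ?_⟩
  · rw [sum_add_distrib, sum_ite_eq' univ j₀]
    have : ∑ j, (if prec (e j) u then (-1 : ℝ) else if prec u (e j) then 1 else 0)
        < ∑ j : Fin q, 1 := by
      refine sum_lt_sum (fun j _ => ?_) ⟨j₀, mem_univ _, ?_⟩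
      · split_ifs <;> norm_num
      · rw [if_pos hj]; norm_num
    simp at this ⊢
    linarith
  · intro j h
    have h1 : ¬ prec u u := hs.irrefl u
    have h2 : j ≠ j₀ := by rintro rfl; rw [h] at hj; exact h1 hj
    simp [h, h1, h2]
  · intro j h
    have : (0 : ℝ) ≤ q := q.cast_nonneg
    simp only [if_pos h]
    split_ifs <;> linarith
  · intro j h
    have h2 : j ≠ j₀ := by rintro rfl; exact has _ _ h hj
    simp [h, has _ _ h, h2]

variable {q m : ℕ} {v : Fin (q + 1) ⊕ Fin (m + 1) → Fin (q + 1) → ℝ}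
  {prec : Fin (q + 1) ⊕ Fin (m + 1) → Fin (q + 1) ⊕ Fin (m + 1) → Prop}

theorem map_inr_eq
    (hv : ∀ i, v (Sum.inr i) = ∑ j : Fin q, v (Sum.inl j.castSucc)
      + ((i : ℕ) + 2 : ℝ) • v (Sum.inl (Fin.last q)))
    (φ : (Fin (q + 1) → ℝ) →ₗ[ℝ] ℝ) (i : Fin (m + 1)) :
    φ (v (Sum.inr i)) = ∑ j : Fin q, φ (v (Sum.inl j.castSucc))
      + ((i : ℕ) + 2 : ℝ) * φ (v (Sum.inl (Fin.last q))) := by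
  rw [hv, map_add, map_sum, map_smul, smul_eq_mul]

theorem IsMonotonePathOrder.isChainShuffle
    (hv : ∀ i, v (Sum.inr i) = ∑ j : Fin q, v (Sum.inl j.castSucc)
      + ((i : ℕ) + 2 : ℝ) • v (Sum.inl (Fin.last q)))
    (h : IsMonotonePathOrder v prec) (hl : ∀ i, prec (Sum.inr i) (Sum.inl (Fin.last q))) :
    IsChainShuffle prec := by
  obtain ⟨hs, h⟩ := h
  have tri : ∀ a b, a ≠ b → ¬ prec a b → prec b a := fun a b hab h1 => by
    by_contra h2
    exact hab (hs.trichotomous a b h1 h2)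
  refine ⟨hs, fun i k hik => ?_, hl, ?_⟩
  · obtain ⟨φ, h0, hn, hp⟩ := h (Sum.inr i)
    have ht := hp _ (hl i)
    refine tri _ _ (by simpa using hik.ne') fun hki => ?_
    have h1 := hn _ hki
    rw [map_inr_eq hv] at h0 h1
    have : ((i : ℕ) : ℝ) < (k : ℕ) := by exact_mod_cast hik
    nlinarith
  · obtain ⟨φ, h0, hn, hp⟩ := h (Sum.inr 0)
    have ht := hp _ (hl 0)
    rw [map_inr_eq hv] at h0
    by_contra! hc
    have : 0 ≤ ∑ j : Fin q, φ (v (Sum.inl j.castSucc)) :=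
      sum_nonneg fun j _ => (hp _ (tri _ _ (by simp) (hc j))).le
    simp at h0
    linarith

theorem IsMonotonePathOrder.isChainShuffle_or_swap
    (hv : ∀ i, v (Sum.inr i) = ∑ j : Fin q, v (Sum.inl j.castSucc)
      + ((i : ℕ) + 2 : ℝ) • v (Sum.inl (Fin.last q)))
    (h : IsMonotonePathOrder v prec) :
    IsChainShuffle prec ∨ IsChainShuffle (Function.swap prec) := by
  obtain ⟨φ, h0, hn, hp⟩ := h.2 (Sum.inl (Fin.last q))
  have tri : ∀ a b, a ≠ b → ¬ prec a b → prec b a := fun a b hab h1 => by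
    by_contra h2
    exact hab (h.1.trichotomous a b h1 h2)
  have hφ : ∀ i, φ (v (Sum.inr i)) = φ (v (Sum.inr 0)) := fun i => by
    rw [map_inr_eq hv, map_inr_eq hv, h0]; simp
  by_cases hc : prec (Sum.inr 0) (Sum.inl (Fin.last q))
  · refine Or.inl (h.isChainShuffle hv fun i => tri _ _ (by simp) fun hi => ?_)
    have h1 := hn _ hc
    have h2 := hp _ hi
    rw [hφ] at h2
    linarith
  · refine Or.inr (h.swap.isChainShuffle hv fun i => tri _ _ (by simp) fun hi => ?_)
    have h1 := hp _ (tri _ _ (by simp) hc)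
    have h2 := hn _ hi
    rw [hφ] at h2
    linarith

theorem IsChainShuffle.isMonotonePathOrder
    (hv1 : ∀ j, v (Sum.inl j) = Pi.single j 1)
    (hv : ∀ i, v (Sum.inr i) = ∑ j : Fin q, v (Sum.inl j.castSucc)
      + ((i : ℕ) + 2 : ℝ) • v (Sum.inl (Fin.last q)))
    (h : IsChainShuffle prec) : IsMonotonePathOrder v prec := by
  obtain ⟨hs, hc, hl, j₀, hj₀⟩ := h
  have has : ∀ a b, prec a b → ¬ prec b a := fun a b h h' => hs.irrefl a (hs.trans _ _ _ h h')
  have tri : ∀ a b, a ≠ b → ¬ prec a b → prec b a := fun a b hab h1 => by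
    by_contra h2
    exact hab (hs.trichotomous a b h1 h2)
  have hc0 : ∀ i a, prec a (Sum.inr 0) → prec a (Sum.inr i) := fun i a ha => by
    rcases (Fin.zero_le i).eq_or_lt with h0 | h0
    · rwa [← h0]
    · exact hs.trans _ _ _ ha (hc _ _ h0)
  have key : ∀ (x : Fin q → ℝ) (t : ℝ), ∃ φ : (Fin (q + 1) → ℝ) →ₗ[ℝ] ℝ,
      (∀ j : Fin q, φ (v (Sum.inl j.castSucc)) = x j) ∧ φ (v (Sum.inl (Fin.last q))) = t ∧
      ∀ i, φ (v (Sum.inr i)) = ∑ j, x j + ((i : ℕ) + 2 : ℝ) * t := fun x t => by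
    let φ := (Pi.basisFun ℝ (Fin (q + 1))).constr ℝ (Fin.snoc (α := fun _ => ℝ) x t)
    have hφ : ∀ j, φ (v (Sum.inl j)) = Fin.snoc (α := fun _ => ℝ) x t j := fun j => by
      rw [hv1, ← Pi.basisFun_apply, Module.Basis.constr_basis]
    have h1 : ∀ j : Fin q, φ (v (Sum.inl j.castSucc)) = x j := fun j => by
      rw [hφ, Fin.snoc_castSucc]
    have h2 : φ (v (Sum.inl (Fin.last q))) = t := by rw [hφ, Fin.snoc_last]
    exact ⟨φ, h1, h2, fun i => by rw [map_inr_eq hv, h2]; simp only [h1]⟩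
  have build : ∀ u (x : Fin q → ℝ) (t : ℝ),
      (∀ j : Fin q, Sum.inl j.castSucc = u → x j = 0) →
      (∀ j : Fin q, prec (Sum.inl j.castSucc) u → x j < 0) →
      (∀ j : Fin q, prec u (Sum.inl j.castSucc) → 0 < x j) →
      (Sum.inl (Fin.last q) = u → t = 0) → (prec (Sum.inl (Fin.last q)) u → t < 0) →
      (prec u (Sum.inl (Fin.last q)) → 0 < t) →
      (∀ i, Sum.inr i = u → ∑ j, x j + ((i : ℕ) + 2 : ℝ) * t = 0) →
      (∀ i, prec (Sum.inr i) u → ∑ j, x j + ((i : ℕ) + 2 : ℝ) * t < 0) →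
      (∀ i, prec u (Sum.inr i) → 0 < ∑ j, x j + ((i : ℕ) + 2 : ℝ) * t) →
      ∃ φ : (Fin (q + 1) → ℝ) →ₗ[ℝ] ℝ,
        φ (v u) = 0 ∧ (∀ w, prec w u → φ (v w) < 0) ∧ (∀ w, prec u w → 0 < φ (v w)) := by
    intro u x t e1 e2 e3 t1 t2 t3 a1 a2 a3
    obtain ⟨φ, k1, k2, k3⟩ := key x t
    have sum_cases : ∀ C : Fin (q + 1) ⊕ Fin (m + 1) → Prop, (∀ j : Fin q, C (Sum.inl j.castSucc)) →
        C (Sum.inl (Fin.last q)) → (∀ i, C (Sum.inr i)) → ∀ w, C w := by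
      rintro C c1 c2 c3 (j | i)
      · induction j using Fin.lastCases with
        | last => exact c2
        | cast j => exact c1 j
      · exact c3 i
    refine ⟨φ, ?_, ?_, ?_⟩
    · exact sum_cases (fun w => w = u → φ (v w) = 0) (fun j => by simpa only [k1] using e1 j)
        (by simpa only [k2] using t1) (fun i => by simpa only [k3] using a1 i) u rfl
    · exact sum_cases _ (fun j => by simpa only [k1] using e2 j)
        (by simpa only [k2] using t2) (fun i => by simpa only [k3] using a2 i)
    · exact sum_cases _ (fun j => by simpa only [k1] using e3 j)
        (by simpa only [k2] using t3) (fun i => by simpa only [k3] using a3 i)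
  refine ⟨hs, ?_⟩
  have hpos : ∀ k : Fin (m + 1), (0 : ℝ) < (k : ℕ) + 2 := fun k => by positivity
  rintro (j | i)
  · induction j using Fin.lastCases with
    | last =>
      obtain ⟨x, xs, x1, x2, x3⟩ := exists_signed_neg_sum hs
        (fun j : Fin q => Sum.inl j.castSucc) (Sum.inl (Fin.last q)) j₀
        (hs.trans _ _ _ hj₀ (hl 0))
      refine build _ x 0 x1 x2 x3 (fun _ => rfl) (fun h => (hs.irrefl _ h).elim)
        (fun h => (hs.irrefl _ h).elim) (fun i h => by cases h) (fun i _ => by simpa using xs)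
        (fun i h => (has _ _ h (hl i)).elim)
    | cast j =>
      by_cases hj : ∃ j₁ : Fin q, prec (Sum.inl j₁.castSucc) (Sum.inl j.castSucc)
      · obtain ⟨j₁, hj₁⟩ := hj
        obtain ⟨x, xs, x1, x2, x3⟩ := exists_signed_neg_sum hs
          (fun j : Fin q => Sum.inl j.castSucc) (Sum.inl j.castSucc) j₁ hj₁
        by_cases hlj : prec (Sum.inl (Fin.last q)) (Sum.inl j.castSucc)
        · refine build _ x (∑ j, x j) x1 x2 x3 (fun h => ?_) (fun _ => xs)
            (fun h => (has _ _ h hlj).elim) (fun i h => by cases h)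
            (fun i _ => ?_) (fun i h => (has _ _ h (hs.trans _ _ _ (hl i) hlj)).elim)
          · rw [h] at hlj; exact (hs.irrefl _ hlj).elim
          · nlinarith [hpos i]
        · obtain ⟨n, hn⟩ := exists_threshold
            (fun i : Fin (m + 1) => prec (Sum.inr i) (Sum.inl j.castSucc))
            (fun i k hik hk => hs.trans _ _ _ (hc i k hik) hk)
          have hcpos : (0 : ℝ) < n + 3 / 2 := by positivity
          have ht : 0 < -(∑ j, x j) / (n + 3 / 2) := div_pos (by linarith) hcpos
          have hsum : ∑ j, x j = -(n + 3 / 2) * (-(∑ j, x j) / (n + 3 / 2)) := by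
            field_simp
          refine build _ x (-(∑ j, x j) / (n + 3 / 2)) x1 x2 x3 (fun h => ?_)
            (fun h => (hlj h).elim) (fun _ => ht) (fun i h => by cases h) (fun i h => ?_)
            (fun i h => ?_)
          · have := Sum.inl_injective h
            exact absurd this (Fin.castSucc_lt_last j).ne'
          · have : ((i : ℕ) : ℝ) + 1 ≤ n := by exact_mod_cast (hn i).1 h
            generalize -(∑ j, x j) / (n + 3 / 2) = t at *
            rw [hsum]; nlinarith
          · have h' : ¬ (i : ℕ) < n := fun h2 => has _ _ h ((hn i).2 h2)
            have : (n : ℝ) ≤ (i : ℕ) := by exact_mod_cast not_lt.1 h'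
            generalize -(∑ j, x j) / (n + 3 / 2) = t at *
            rw [hsum]; nlinarith
      · push Not at hj
        have h0 : prec (Sum.inl j.castSucc) (Sum.inr 0) := by
          by_cases e : j₀ = j
          · rwa [← e]
          · exact hs.trans _ _ _ (tri _ _ (by simpa using e) (hj j₀)) hj₀
        have hx : (0 : ℝ) ≤ ∑ k : Fin q, if k = j then (0 : ℝ) else 1 :=
          sum_nonneg fun k _ => by split_ifs <;> norm_num
        have hjl := hs.trans _ _ _ h0 (hl 0)
        refine build _ (fun k => if k = j then 0 else 1) 1 (fun k h => ?_) (fun k h => (hj k h).elim)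
          (fun k h => ?_) (fun h => ?_) (fun h => (has _ _ h hjl).elim) (fun _ => one_pos)
          (fun i h => by cases h) (fun i h => (has _ _ h (hc0 i _ h0)).elim) (fun i _ => ?_)
        · have : k = j := by simpa using h
          simp [this]
        · have : k ≠ j := by rintro rfl; exact hs.irrefl _ h
          simp [this]
        · rw [h] at hjl; exact (hs.irrefl _ hjl).elim
        · linarith [hpos i]
  · obtain ⟨x, xs, x1, x2, x3⟩ := exists_signed_neg_sum hs
      (fun j : Fin q => Sum.inl j.castSucc) (Sum.inr i) j₀ (hc0 i _ hj₀)
    have ht : 0 < -(∑ j, x j) / ((i : ℕ) + 2) := div_pos (by linarith) (hpos i)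
    have hsum : ∑ j, x j = -((i : ℕ) + 2) * (-(∑ j, x j) / ((i : ℕ) + 2)) := by
      have := (hpos i).ne'
      field_simp
    have hik : ∀ a b, prec (Sum.inr a) (Sum.inr b) → a < b := fun a b h => by
      by_contra! hle
      rcases hle.eq_or_lt with he | hlt
      · rw [he] at h; exact hs.irrefl _ h
      · exact has _ _ h (hc _ _ hlt)
    refine build _ x (-(∑ j, x j) / ((i : ℕ) + 2)) x1 x2 x3 (fun h => by cases h)
      (fun h => (has _ _ h (hl i)).elim) (fun _ => ht) (fun k h => ?_) (fun k h => ?_)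
      (fun k h => ?_)
    · cases h
      generalize -(∑ j, x j) / ((i : ℕ) + 2 : ℝ) = t at *
      rw [hsum]; ring
    · have : ((k : ℕ) : ℝ) < (i : ℕ) := by exact_mod_cast hik _ _ h
      generalize -(∑ j, x j) / ((i : ℕ) + 2 : ℝ) = t at *
      rw [hsum]; nlinarith
    · have : ((i : ℕ) : ℝ) < (k : ℕ) := by exact_mod_cast hik _ _ h
      generalize -(∑ j, x j) / ((i : ℕ) + 2 : ℝ) = t at *
      rw [hsum]; nlinarith

end Geometry

/-- For `r ≥ 2` and `m ≥ 1`, the number of monotone path orders of the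
configuration `E_{r,m}` equals `2 · (r−1)! · C(m+r−1, m+1)`. -/
theorem statement12 (r m : ℕ) (hr : 2 ≤ r) (hm : 1 ≤ m)
    (v : Fin r ⊕ Fin m → Fin r → ℝ)
    (hv1 : ∀ j : Fin r, v (Sum.inl j) = Pi.single j 1)
    (hv2 : ∀ i : Fin m, v (Sum.inr i)
      = fun k : Fin r => (if (k : ℕ) = r - 1 then ((i : ℕ) + 1 : ℝ) else 0) + 1) :
    {prec : Fin r ⊕ Fin m → Fin r ⊕ Fin m → Prop |
      IsStrictTotalOrder (Fin r ⊕ Fin m) prec ∧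
      ∀ u : Fin r ⊕ Fin m, ∃ φ : (Fin r → ℝ) →ₗ[ℝ] ℝ,
        φ (v u) = 0 ∧ (∀ w, prec w u → φ (v w) < 0) ∧
        (∀ w, prec u w → 0 < φ (v w))}.ncard
      = 2 * Nat.factorial (r - 1) * Nat.choose (m + r - 1) (m + 1) := by
  obtain ⟨q, rfl⟩ : ∃ q, r = q + 1 := ⟨r - 1, by omega⟩
  obtain ⟨m, rfl⟩ : ∃ n, m = n + 1 := ⟨m - 1, by omega⟩
  have hv : ∀ i, v (Sum.inr i) = ∑ j : Fin q, v (Sum.inl j.castSucc)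
      + ((i : ℕ) + 2 : ℝ) • v (Sum.inl (Fin.last q)) := fun i => by
    funext k
    simp only [hv2, hv1, Pi.add_apply, Finset.sum_apply, Pi.smul_apply, smul_eq_mul]
    induction k using Fin.lastCases with
    | last =>
      simp
      ring
    | cast k =>
      have h1 : (k : ℕ) ≠ q := k.2.ne
      simp [h1, Pi.single_apply]
  have hset : {prec | IsMonotonePathOrder v prec} =
      {prec | IsChainShuffle prec} ∪ Function.swap '' {prec | IsChainShuffle prec} := by
    ext prec
    constructor
    · intro h
      rcases IsMonotonePathOrder.isChainShuffle_or_swap hv h with h | h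
      · exact Or.inl h
      · exact Or.inr ⟨_, h, rfl⟩
    · rintro (h | ⟨p, h, rfl⟩)
      · exact IsChainShuffle.isMonotonePathOrder hv1 hv h
      · exact (IsChainShuffle.isMonotonePathOrder hv1 hv h).swap
  have hdisj : Disjoint {prec | IsChainShuffle (q := q) (m := m) prec}
      (Function.swap '' {prec | IsChainShuffle prec}) := by
    rw [Set.disjoint_left]
    rintro _ h ⟨p, hp, rfl⟩
    have hs : IsStrictTotalOrder _ p := hp.1
    exact hs.irrefl _ (hs.trans _ _ _ (hp.2.2.1 0) (h.2.2.1 0))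
  change {prec | IsMonotonePathOrder v prec}.ncard = _
  rw [hset, Set.ncard_union_eq hdisj (Set.toFinite _) (Set.toFinite _), Set.ncard_image_of_injective _
    (Function.LeftInverse.injective (g := Function.swap) fun _ => rfl), ncard_isChainShuffle,
    Nat.add_sub_cancel, show m + 1 + (q + 1) - 1 = m + 1 + q by omega]
  ring
end

section
/- Let r, m be positive integers and let S be a finite set that is the disjoint union of {x_1, …, x_r} and {y_1, …, y_m} (r + m distinct elements). Then the number of linear orders ≺ on S such that the ≺-maximum and ≺-minimum elements of S both belong to {x_1, …, x_r}, and either x_r ≺ y_m ≺ ⋯ ≺ y_1 or y_1 ≺ ⋯ ≺ y_m ≺ x_r, equals 2 · (r−1)! · binom(m+r−1, m+1). -/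
open Finset

/-- Enumerations `e` of `S` which are increasing along `c` and whose first element is not in the
range of `c`. -/
def chainEnumerations {S : Type*} {n k : ℕ} (c : Fin k ↪ S) : Set (S ≃ Fin (n + 1)) :=
  {e | StrictMono (e ∘ c) ∧ e.symm 0 ∉ Set.range c}

theorem card_enumerations_first_notMem {S : Type*} [Fintype S] {n k : ℕ} (c : Fin k ↪ S)
    (hS : Fintype.card S = n + 1) :
    Nat.card {e : S ≃ Fin (n + 1) // e.symm 0 ∉ Set.range c} = (n + 1 - k) * n.factorial := by
  classical
  let g : S ≃ Fin (n + 1) := Fintype.equivFinOfCardEq hS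
  let E : (S ≃ Fin (n + 1)) ≃ Fin (n + 1) × Equiv.Perm (Fin n) :=
    (Equiv.equivCongr g (Equiv.refl _)).trans
      ((Equiv.inv (Equiv.Perm (Fin (n + 1)))).trans Equiv.Perm.decomposeFin)
  have hE (e : S ≃ Fin (n + 1)) : (E e).1 = g (e.symm 0) := by
    have h (σ : Equiv.Perm (Fin (n + 1))) : (Equiv.Perm.decomposeFin σ).1 = σ 0 := by
      obtain ⟨⟨p, q⟩, rfl⟩ := Equiv.Perm.decomposeFin.symm.surjective σ
      simp
    exact h _
  have h₁ : {e : S ≃ Fin (n + 1) // e.symm 0 ∉ Set.range c} ≃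
      {x : S // x ∉ Set.range c} × Equiv.Perm (Fin n) :=
    ((E.trans (Equiv.prodCongr g.symm (Equiv.refl _))).subtypeEquiv
      (q := fun p => p.1 ∉ Set.range c) (by intro e; simp [hE])).trans
        (Equiv.prodSubtypeFstEquivSubtypeProd (p := fun x => x ∉ Set.range c))
  rw [Nat.card_congr h₁, Nat.card_prod, Nat.card_eq_fintype_card, Nat.card_eq_fintype_card,
    Fintype.card_perm, Fintype.card_fin]
  congr 1
  rw [Fintype.card_subtype_compl, hS]
  congr 1
  exact (Fintype.card_congr (Equiv.ofInjective c c.injective)).symm.trans (Fintype.card_fin k)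

theorem ncard_chainEnumerations_mul_factorial {S : Type*} [Fintype S] {n k : ℕ} (c : Fin k ↪ S)
    (hS : Fintype.card S = n + 1) :
    (chainEnumerations (n := n) c).ncard * k.factorial = (n + 1 - k) * n.factorial := by
  classical
  rw [← card_enumerations_first_notMem c hS, ← Nat.card_coe_set_eq]
  have hk : k.factorial = Nat.card (Equiv.Perm (Fin k)) := by
    rw [Nat.card_eq_fintype_card, Fintype.card_perm, Fintype.card_fin]
  rw [hk, ← Nat.card_prod]
  have hQ (g : S ≃ Fin (n + 1)) (hg : g.symm 0 ∉ Set.range c) (σ : Equiv.Perm (Fin k)) :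
      ((σ.viaEmbedding c).trans g).symm 0 ∉ Set.range c := by
    rintro ⟨i, hi⟩
    refine hg ⟨σ i, ?_⟩
    rw [← Equiv.Perm.viaEmbedding_apply, hi]
    simp
  refine Nat.card_congr (Equiv.ofBijective
    (fun p => ⟨(p.2.viaEmbedding c).trans p.1.1, hQ _ p.1.2.2 p.2⟩) ⟨?_, ?_⟩)
  · rintro ⟨⟨e, he, he'⟩, σ⟩ ⟨⟨e', hf, hf'⟩, τ⟩ h
    have h : (σ.viaEmbedding c).trans e = (τ.viaEmbedding c).trans e' := congrArg Subtype.val h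
    have hc (i : Fin k) : e (c (σ i)) = e' (c (τ i)) := by
      simpa [Equiv.Perm.viaEmbedding_apply] using DFunLike.congr_fun h (c i)
    have hr : e ∘ c = e' ∘ c := by
      refine (he.range_inj hf).1 ?_
      rw [← σ.surjective.range_comp (e ∘ c), ← τ.surjective.range_comp (e' ∘ c)]
      exact congrArg Set.range (funext hc)
    have hστ : σ = τ := by
      ext1 i
      refine he.injective ((hc i).trans ?_)
      exact (congrFun hr (τ i)).symm
    subst hστ
    have : e = e' := by
      ext1 x
      simpa using DFunLike.congr_fun h ((σ.viaEmbedding c).symm x)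
    subst this
    rfl
  · rintro ⟨g, hg⟩
    let σ : Equiv.Perm (Fin k) := Tuple.sort (g ∘ c)
    refine ⟨⟨⟨(σ.viaEmbedding c).trans g, ?_, hQ g hg σ⟩, σ⁻¹⟩, ?_⟩
    · have h : ((σ.viaEmbedding c).trans g) ∘ c = (g ∘ c) ∘ σ := by
        ext i
        simp [Equiv.Perm.viaEmbedding_apply]
      rw [h]
      exact (Tuple.monotone_sort (g ∘ c)).strictMono_of_injective
        ((g.injective.comp c.injective).comp σ.injective)
    · have h : σ⁻¹.viaEmbedding c = (σ.viaEmbedding c)⁻¹ :=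
        map_inv (Equiv.Perm.viaEmbeddingHom c) σ
      ext1
      ext1 x
      simp [h]

theorem injective_enumeration_lt (S : Type*) (n : ℕ) :
    Function.Injective (fun (e : S ≃ Fin n) (a b : S) => e a < e b) := by
  intro e e' h
  have h' (a b : S) : e a < e b ↔ e' a < e' b := iff_of_eq (congrFun (congrFun h a) b)
  let φ : Fin n ≃o Fin n :=
    { toEquiv := e.symm.trans e'
      map_rel_iff' := by
        intro a b
        have := h' (e.symm b) (e.symm a)
        simp only [Equiv.apply_symm_apply] at this
        simp only [Equiv.trans_apply]
        rw [← not_lt, ← not_lt, this] }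
  have hφ : φ = OrderIso.refl _ := Subsingleton.elim _ _
  ext1 x
  have := DFunLike.congr_fun hφ (e x)
  simpa [φ] using this.symm

theorem exists_enumeration_lt_eq {S : Type*} [Fintype S] {n : ℕ} (hS : Fintype.card S = n)
    (prec : S → S → Prop) (h : IsStrictTotalOrder S prec) :
    ∃ e : S ≃ Fin n, (fun a b => e a < e b) = prec := by
  classical
  let _ : LinearOrder S := linearOrderOfSTO prec
  let e : Fin n ≃o S := Fintype.orderIsoFinOfCardEq S hS
  refine ⟨e.symm.toEquiv, ?_⟩
  funext a b
  exact propext e.symm.lt_iff_lt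

theorem isStrictTotalOrder_enumeration_lt {S : Type*} {n : ℕ} (e : S ≃ Fin n) :
    IsStrictTotalOrder S (fun a b => e a < e b) where
  trichotomous _ _ h₁ h₂ := e.injective (le_antisymm (not_lt.1 h₂) (not_lt.1 h₁))
  irrefl a := lt_irrefl (e a)
  trans _ _ _ h₁ h₂ := lt_trans h₁ h₂

theorem flip_isStrictTotalOrder {S : Type*} {prec : S → S → Prop}
    (h : IsStrictTotalOrder S prec) : IsStrictTotalOrder S (flip prec) where
  trichotomous a b h₁ h₂ := h.trichotomous a b h₂ h₁
  irrefl a := h.irrefl a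
  trans a b c h₁ h₂ := h.trans c b a h₂ h₁

/-- The chain `y_1, …, y_m, x` in `S`. -/
def snocChain {α S : Type*} {m : ℕ} (f : α ⊕ Fin m ≃ S) (x : α) : Fin (m + 1) ↪ S where
  toFun := Fin.snoc (α := fun _ => S) (fun i => f (Sum.inr i)) (f (Sum.inl x))
  inj' := by
    intro a b
    refine Fin.lastCases ?_ (fun i => ?_) a <;> refine Fin.lastCases ?_ (fun j => ?_) b <;> simp

@[simp]
theorem snocChain_castSucc {α S : Type*} {m : ℕ} (f : α ⊕ Fin m ≃ S) (x : α) (i : Fin m) :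
    snocChain f x i.castSucc = f (Sum.inr i) :=
  Fin.snoc_castSucc (α := fun _ => S) (f (Sum.inl x)) (fun i => f (Sum.inr i)) i

@[simp]
theorem snocChain_last {α S : Type*} {m : ℕ} (f : α ⊕ Fin m ≃ S) (x : α) :
    snocChain f x (Fin.last m) = f (Sum.inl x) :=
  Fin.snoc_last (α := fun _ => S) (f (Sum.inl x)) (fun i => f (Sum.inr i))

/-- Strict total orders on `S` with extreme elements in `f (inl _)` and `y_1 ≺ ⋯ ≺ y_m ≺ x`, where
`y_i = f (inr i)` and `l` is the index of `y_m`. -/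
def chainOrders {α S : Type*} {m : ℕ} (f : α ⊕ Fin m ≃ S) (x : α) (l : Fin m) :
    Set (S → S → Prop) :=
  {prec | IsStrictTotalOrder S prec ∧
    (∃ j : α, ∀ u, u ≠ f (Sum.inl j) → prec (f (Sum.inl j)) u) ∧
    (∃ j : α, ∀ u, u ≠ f (Sum.inl j) → prec u (f (Sum.inl j))) ∧
    (∀ i i' : Fin m, i < i' → prec (f (Sum.inr i)) (f (Sum.inr i'))) ∧
      prec (f (Sum.inr l)) (f (Sum.inl x))}

theorem chainOrders_eq_image {α S : Type*} [Fintype S] {m n : ℕ} (f : α ⊕ Fin m ≃ S) (x : α)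
    (l : Fin m) (hl : ∀ i, i ≤ l) (hS : Fintype.card S = n + 1) :
    chainOrders f x l =
      (fun (e : S ≃ Fin (n + 1)) (a b : S) => e a < e b) ''
        chainEnumerations (n := n) (snocChain f x) := by
  ext prec
  constructor
  · rintro ⟨hp, ⟨j, hj⟩, -, hy, hx⟩
    obtain ⟨e, rfl⟩ := exists_enumeration_lt_eq hS prec hp
    have hyx (i : Fin m) : e (f (Sum.inr i)) < e (f (Sum.inl x)) := by
      rcases (hl i).eq_or_lt with rfl | h
      · exact hx
      · exact (hy i l h).trans hx
    have hj0 : e.symm 0 = f (Sum.inl j) := by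
      by_contra h
      simpa using hj _ h
    refine ⟨e, ⟨?_, ?_⟩, rfl⟩
    · intro a b
      refine Fin.lastCases ?_ (fun i => ?_) a <;> refine Fin.lastCases ?_ (fun j => ?_) b
      · simp
      · intro h
        exact absurd h (Fin.le_last _).not_gt
      · intro _
        simpa using hyx i
      · intro h
        simpa using hy i j h
    · rw [hj0]
      rintro ⟨a, ha⟩
      revert ha
      refine Fin.lastCases ?_ (fun i => ?_) a
      · intro ha
        rw [snocChain_last] at ha
        have h := hj (f (Sum.inr l)) (by simp)
        rw [← ha] at h
        exact lt_asymm h hx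
      · simp
  · rintro ⟨e, ⟨hc, h0⟩, rfl⟩
    have hyx (i : Fin m) : e (f (Sum.inr i)) < e (f (Sum.inl x)) := by
      simpa using hc (Fin.castSucc_lt_last i)
    refine ⟨isStrictTotalOrder_enumeration_lt e, ?_, ?_, fun i i' h => ?_, hyx l⟩
    · obtain ⟨z, hz⟩ := f.surjective (e.symm 0)
      rcases z with j | i
      · refine ⟨j, fun u hu => ?_⟩
        rw [hz] at hu ⊢
        simpa [Fin.pos_iff_ne_zero, Equiv.eq_symm_apply] using hu
      · exact absurd ⟨i.castSucc, by simpa using hz⟩ h0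
    · obtain ⟨z, hz⟩ := f.surjective (e.symm (Fin.last n))
      rcases z with j | i
      · refine ⟨j, fun u hu => ?_⟩
        rw [hz] at hu ⊢
        simpa [Fin.lt_last_iff_ne_last, Equiv.eq_symm_apply] using hu
      · have h := hyx i
        rw [hz, Equiv.apply_symm_apply] at h
        exact absurd h (Fin.le_last _).not_gt
    · simpa using hc (Fin.castSucc_lt_castSucc_iff.2 h)

theorem ncard_chainOrders {r m : ℕ} {S : Type*} [Fintype S] (f : Fin (r + 1) ⊕ Fin m ≃ S)
    (x : Fin (r + 1)) (l : Fin m) (hl : ∀ i, i ≤ l) :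
    (chainOrders f x l).ncard = r.factorial * (m + r).choose (m + 1) := by
  have hS : Fintype.card S = (m + r) + 1 := by
    rw [← Fintype.card_congr f, Fintype.card_sum, Fintype.card_fin, Fintype.card_fin]
    omega
  rw [chainOrders_eq_image f x l hl hS,
    Set.ncard_image_of_injective _ (injective_enumeration_lt S (m + r + 1))]
  refine Nat.eq_of_mul_eq_mul_right (m + 1).factorial_pos ?_
  rw [ncard_chainEnumerations_mul_factorial _ hS]
  cases r with
  | zero => simp
  | succ r =>
    have h := Nat.choose_mul_factorial_mul_factorial (show m + 1 ≤ m + (r + 1) by omega)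
    rw [show m + (r + 1) - (m + 1) = r by omega] at h
    rw [show m + (r + 1) + 1 - (m + 1) = r + 1 by omega, Nat.factorial_succ r, ← h]
    ring

/-- Let `S` be a finite set which is the disjoint union of the `r + m`
distinct elements `x_1, …, x_r, y_1, …, y_m` (encoded by a bijection
`f : Fin r ⊕ Fin m ≃ S`).  The number of linear orders `≺` on `S` whose maximum and minimum
both lie in `{x_1, …, x_r}` and which satisfy `x_r ≺ y_m ≺ ⋯ ≺ y_1` or
`y_1 ≺ ⋯ ≺ y_m ≺ x_r` equals `2 · (r−1)! · C(m+r−1, m+1)`. -/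
theorem statement13 (r m : ℕ) (hr : 1 ≤ r) (hm : 1 ≤ m)
    (S : Type*) [Fintype S] (f : Fin r ⊕ Fin m ≃ S) :
    {prec : S → S → Prop |
      IsStrictTotalOrder S prec ∧
      (∃ j : Fin r, ∀ u, u ≠ f (Sum.inl j) → prec (f (Sum.inl j)) u) ∧
      (∃ j : Fin r, ∀ u, u ≠ f (Sum.inl j) → prec u (f (Sum.inl j))) ∧
      ((prec (f (Sum.inl ⟨r - 1, by omega⟩)) (f (Sum.inr ⟨m - 1, by omega⟩)) ∧
          ∀ i i' : Fin m, i < i' → prec (f (Sum.inr i')) (f (Sum.inr i))) ∨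
       ((∀ i i' : Fin m, i < i' → prec (f (Sum.inr i)) (f (Sum.inr i'))) ∧
          prec (f (Sum.inr ⟨m - 1, by omega⟩)) (f (Sum.inl ⟨r - 1, by omega⟩))))}.ncard
      = 2 * Nat.factorial (r - 1) * Nat.choose (m + r - 1) (m + 1) := by
  obtain ⟨r, rfl⟩ : ∃ k, r = k + 1 := ⟨r - 1, by omega⟩
  set x : Fin (r + 1) := ⟨r + 1 - 1, by omega⟩
  set l : Fin m := ⟨m - 1, by omega⟩ with hl_def
  have hl (i : Fin m) : i ≤ l := by
    rw [hl_def, Fin.le_def]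
    exact Nat.le_sub_one_of_lt i.isLt
  have hflip : Function.Injective (flip : (S → S → Prop) → S → S → Prop) :=
    Function.LeftInverse.injective (g := flip) fun _ => rfl
  have hcard := ncard_chainOrders f x l hl
  have hfin : (chainOrders f x l).Finite := by
    have : Finite (S → S → Prop) := inferInstance
    exact Set.toFinite _
  have hdisj : Disjoint (flip '' chainOrders f x l) (chainOrders f x l) := by
    rw [Set.disjoint_left]
    rintro _ ⟨p, hp, rfl⟩ hq
    exact hp.1.irrefl _ (hp.1.trans _ _ _ hp.2.2.2.2 hq.2.2.2.2)
  have hcount : (flip '' chainOrders f x l ∪ chainOrders f x l).ncard =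
      2 * (r + 1 - 1).factorial * (m + (r + 1) - 1).choose (m + 1) := by
    rw [Set.ncard_union_eq hdisj (hfin.image _) hfin, Set.ncard_image_of_injective _ hflip, hcard,
      Nat.add_sub_cancel, show m + (r + 1) - 1 = m + r by omega]
    ring
  rw [← hcount]
  congr 1
  ext prec
  constructor
  · rintro ⟨hp, hmin, hmax, ⟨hx, hy⟩ | ⟨hy, hx⟩⟩
    · exact Or.inl ⟨flip prec, ⟨flip_isStrictTotalOrder hp, hmax, hmin, hy, hx⟩, rfl⟩
    · exact Or.inr ⟨hp, hmin, hmax, hy, hx⟩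
  · rintro (⟨p, ⟨hp, hmin, hmax, hy, hx⟩, rfl⟩ | ⟨hp, hmin, hmax, hy, hx⟩)
    · exact ⟨flip_isStrictTotalOrder hp, hmax, hmin, Or.inl ⟨hx, hy⟩⟩
    · exact ⟨hp, hmin, hmax, Or.inr ⟨hy, hx⟩⟩
end

section
/- Let (v, π) be a configuration with π(v e) = 1 for every e ∈ E, v injective, and let r = dim span{v e : e ∈ E}. Suppose there is no cellular string (E_1, …, E_l) of (v, π) with l ≥ 2 such that ∑_{i=1}^l (dim span{v e : e ∈ E_i} − 1) ≥ r − 1. Then the convex hull of {v e : e ∈ E} is a simplex, i.e., the set of extreme points of conv{v e : e ∈ E} is affinely independent. -/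
open Finset

section CommonDefs

variable {E : Type*} [Fintype E] {V : Type*} [AddCommGroup V] [Module ℝ V]

/-- An ordered set partition of the finite index set `E` with `l` blocks is encoded by a
surjective block map `b : E → Fin l` (block `E_i = b⁻¹ i`, blocks listed in the order of
`Fin l`).  Such an ordered set partition is a *cellular string* of the configuration `v` if
for each block index `i` there is a linear functional vanishing on the vectors of block `i`,
negative on the vectors of earlier blocks and positive on the vectors of later blocks. -/
def IsCellularString (v : E → V) (l : ℕ) (b : E → Fin l) : Prop :=
  Function.Surjective b ∧
  ∀ i : Fin l, ∃ φ : V →ₗ[ℝ] ℝ, ∀ e : E,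
    (b e = i → φ (v e) = 0) ∧ (b e < i → φ (v e) < 0) ∧ (i < b e → 0 < φ (v e))

/-- A cellular string (ordered set partition) is *coherent* for the configuration `(v, π)` if
some linear functional `ψ` orders the ratios `ψ(v e)/π(v e)` according to the blocks:
equal within a block, strictly increasing between blocks. -/
def IsCoherent (v : E → V) (π : V →ₗ[ℝ] ℝ) (l : ℕ) (b : E → Fin l) : Prop :=
  ∃ ψ : V →ₗ[ℝ] ℝ, ∀ e e' : E,
    (b e = b e' → ψ (v e) / π (v e) = ψ (v e') / π (v e')) ∧
    (b e < b e' → ψ (v e) / π (v e) < ψ (v e') / π (v e'))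

/-- The configuration `(v, π)` is *all-coherent* if every cellular string is coherent. -/
def AllCoherent (v : E → V) (π : V →ₗ[ℝ] ℝ) : Prop :=
  ∀ (l : ℕ) (b : E → Fin l), IsCellularString v l b → IsCoherent v π l b

end CommonDefs

section Configurations

variable {E : Type*} [Fintype E] {V : Type*} [AddCommGroup V] [Module ℝ V]

/-- Grouping the elements of a configuration by the value of the ratio `f / g` of two functionals,
where `g` is positive on the configuration, yields a cellular string. -/
theorem exists_isCellularString_of_ratio (v : E → V) (f g : V →ₗ[ℝ] ℝ) (hg : ∀ e, 0 < g (v e)) :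
    ∃ (l : ℕ) (b : E → Fin l), IsCellularString v l b ∧
      ∀ e e', b e = b e' ↔ f (v e) / g (v e) = f (v e') / g (v e') := by
  classical
  set q : E → ℝ := fun e => f (v e) / g (v e) with hq
  let o := (univ.image q).orderIsoOfFin rfl
  have hmem : ∀ e, q e ∈ univ.image q := fun e => mem_image_of_mem q (mem_univ e)
  refine ⟨_, fun e => o.symm ⟨q e, hmem e⟩, ⟨fun i => ?_, fun i => ?_⟩, fun e e' => ?_⟩
  · obtain ⟨e, -, he⟩ := mem_image.1 (o i).2
    exact ⟨e, by simp [he]⟩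
  · refine ⟨f - (o i : ℝ) • g, fun e => ?_⟩
    have key : (f - (o i : ℝ) • g) (v e) = (q e - o i) * g (v e) := by
      have := (hg e).ne'
      simp only [hq, LinearMap.sub_apply, LinearMap.smul_apply, smul_eq_mul]
      field_simp
    rw [key]
    refine ⟨fun h => ?_, fun h => ?_, fun h => ?_⟩
    · rw [OrderIso.symm_apply_eq] at h
      simp [← h]
    · rw [OrderIso.symm_apply_lt] at h
      exact mul_neg_of_neg_of_pos (sub_neg.2 h) (hg e)
    · rw [OrderIso.lt_symm_apply] at h
      exact mul_pos (sub_pos.2 h) (hg e)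
  · simp [hq]

/-- A point of a configuration on which some nonnegative functional is positive lies off some
facet: there is a nonnegative functional, still positive at the point, whose zero set spans a
subspace of codimension at most one. -/
theorem exists_facet_functional [FiniteDimensional ℝ V] (v : E → V) (π : V →ₗ[ℝ] ℝ)
    (hπ : ∀ e, 0 ≤ π (v e)) (x : E) (hx : 0 < π (v x)) :
    ∃ f : V →ₗ[ℝ] ℝ, (∀ e, 0 ≤ f (v e)) ∧ 0 < f (v x) ∧
      Module.finrank ℝ (Submodule.span ℝ (Set.range v)) ≤
        Module.finrank ℝ (Submodule.span ℝ (v '' {e | f (v e) = 0})) + 1 := by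
  classical
  let zeros : (V →ₗ[ℝ] ℝ) → Finset E := fun f => univ.filter fun e => f (v e) = 0
  obtain ⟨Z, ⟨f, hf, hfx, rfl⟩, hmax⟩ :=
    (Set.toFinite {Z | ∃ f : V →ₗ[ℝ] ℝ, (∀ e, 0 ≤ f (v e)) ∧ 0 < f (v x) ∧ zeros f = Z}).exists_maximal
      ⟨_, π, hπ, hx, rfl⟩
  refine ⟨f, hf, hfx, ?_⟩
  by_contra! hlt
  set W := Submodule.span ℝ (v '' {e | f (v e) = 0}) ⊔ Submodule.span ℝ {v x}
  have hWlt : Module.finrank ℝ W < Module.finrank ℝ (Submodule.span ℝ (Set.range v)) :=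
    (Submodule.finrank_add_le_finrank_add_finrank _ _).trans_lt
      ((add_le_add_right (finrank_span_singleton (K := ℝ) fun h0 => hx.ne' (by rw [h0, map_zero])).le _).trans_lt hlt)
  obtain ⟨e₁, he₁⟩ : ∃ e, v e ∉ W := by
    by_contra! h
    exact hWlt.not_ge (Submodule.finrank_mono (Submodule.span_le.2 (Set.range_subset_iff.2 h)))
  obtain ⟨h, hWh, hne⟩ : ∃ h : V →ₗ[ℝ] ℝ, (∀ w ∈ W, h w = 0) ∧ h (v e₁) < 0 := by
    obtain ⟨h, h₁, h₂⟩ := Submodule.exists_le_ker_of_notMem he₁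
    rcases lt_or_gt_of_ne h₁ with h₁ | h₁
    · exact ⟨h, fun w hw => h₂ hw, h₁⟩
    · exact ⟨-h, fun w hw => by simpa using h₂ hw, by simpa using h₁⟩
  have hzero : ∀ e, f (v e) = 0 → h (v e) = 0 := fun e he =>
    hWh _ (Submodule.mem_sup_left (Submodule.subset_span ⟨e, he, rfl⟩))
  have hhx : h (v x) = 0 :=
    hWh _ (Submodule.mem_sup_right (Submodule.mem_span_singleton_self _))
  obtain ⟨e₀, he₀, hmin⟩ := (univ.filter fun e => h (v e) < 0).exists_min_image
    (fun e => f (v e) / -h (v e)) ⟨e₁, by simpa using hne⟩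
  simp only [mem_filter, mem_univ, true_and] at he₀ hmin
  set t := f (v e₀) / -h (v e₀) with ht
  have ht0 : 0 ≤ t := div_nonneg (hf _) (by linarith)
  have hsub : zeros f ⊆ zeros (f + t • h) := fun e he => by
    have he : f (v e) = 0 := by simpa [zeros] using he
    simp [zeros, he, hzero e he]
  have hmem : e₀ ∈ zeros (f + t • h) := by
    have := he₀.ne
    simp only [zeros, mem_filter, mem_univ, true_and, LinearMap.add_apply, LinearMap.smul_apply,
      smul_eq_mul, ht]
    field_simp
    ring
  have hback := hmax ⟨f + t • h, fun e => ?_, by simpa [hhx] using hfx, rfl⟩ hsub hmem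
  · exact he₀.ne (hzero e₀ (by simpa [zeros] using hback))
  · simp only [LinearMap.add_apply, LinearMap.smul_apply, smul_eq_mul]
    rcases lt_or_ge (h (v e)) 0 with hneg | hpos
    · have := hmin e hneg
      rw [le_div_iff₀ (by linarith)] at this
      linarith
    · exact add_nonneg (hf e) (mul_nonneg ht0 hpos)

/-- A functional nonnegative on a configuration becomes positive on it after adding a large multiple
of it to any functional that is positive on its zero set. -/
theorem exists_pos_smul_add (v : E → V) (f h : V →ₗ[ℝ] ℝ) (hf : ∀ e, 0 ≤ f (v e))
    (hh : ∀ e, f (v e) = 0 → 0 < h (v e)) : ∃ M : ℝ, ∀ e, 0 < (M • f + h) (v e) := by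
  refine (Filter.eventually_all.2 fun e => ?_ :
    ∀ᶠ M : ℝ in Filter.atTop, ∀ e, 0 < (M • f + h) (v e)).exists
  simp only [LinearMap.add_apply, LinearMap.smul_apply, smul_eq_mul]
  rcases (hf e).eq_or_lt with h0 | hpos
  · exact Filter.Eventually.of_forall fun M => by simpa [← h0] using hh e h0.symm
  · exact (Filter.tendsto_atTop_add_const_right _ _
      (Filter.tendsto_id.atTop_mul_const hpos)).eventually_gt_atTop 0

end Configurations

section ExtremePoints

variable {V : Type*} [AddCommGroup V] [Module ℝ V]

/-- If `f` is positive at the distinct extreme points `x`, `y` of a set lying in the hyperplane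
`π = 1`, then the line through them misses the zero set of `f` on that set. -/
theorem notMem_span_pair_of_mem_extremePoints {P : Set V} {π f : V →ₗ[ℝ] ℝ}
    (hπ : ∀ p ∈ P, π p = 1) {x y : V} (hx : x ∈ P.extremePoints ℝ) (hy : y ∈ P.extremePoints ℝ)
    (hfx : 0 < f x) (hfy : 0 < f y) {w : V} (hw : w ∈ P) (hfw : f w = 0) :
    w ∉ Submodule.span ℝ {x, y} := by
  have key : ∀ {x y : V}, x ∈ P.extremePoints ℝ → y ∈ P → 0 < f x → ∀ {a b : ℝ},
      0 < a → b < 0 → a + b = 1 → a • x + b • y = w → False := by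
    intro x y hx hy hfx a b ha hb hab hw'
    have hseg : x ∈ openSegment ℝ w y := by
      refine ⟨a⁻¹, -b / a, inv_pos.2 ha, div_pos (neg_pos.2 hb) ha, ?_, ?_⟩
      · field_simp
        linarith
      · rw [← hw', smul_add, smul_smul, smul_smul, inv_mul_cancel₀ ha.ne', one_smul, add_assoc,
          ← add_smul]
        have : a⁻¹ * b + -b / a = 0 := by field_simp; ring
        simp [this]
    have := hx.2 hw hy hseg
    rw [← this, hfw] at hfx
    exact hfx.false
  intro hspan
  obtain ⟨a, b, hab⟩ := Submodule.mem_span_pair.1 hspan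
  have h1 : a + b = 1 := by
    have := congrArg π hab
    simpa [hπ x hx.1, hπ y hy.1, hπ w hw] using this
  have h2 : a * f x + b * f y = 0 := by
    have := congrArg f hab
    simpa [hfw] using this
  rcases lt_trichotomy b 0 with hb | hb | hb
  · exact key hx hy.1 hfx (by linarith) hb h1 hab
  · subst hb
    have : a = 1 := by linarith
    subst this
    linarith
  · have ha : a < 0 := by
      by_contra! ha
      nlinarith [mul_pos hb hfy, mul_nonneg ha hfx.le]
    exact key hy hx.1 hfy hb ha (by linarith) (by rw [add_comm]; exact hab)

/-- A linearly independent family is affinely independent. -/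
theorem LinearIndependent.affineIndependent_of_module {ι : Type*} {p : ι → V}
    (hp : LinearIndependent ℝ p) : AffineIndependent ℝ p := by
  rw [affineIndependent_iff]
  exact fun s w _ hw => linearIndependent_iff'.1 hp s w hw

end ExtremePoints

/-- A finite set whose convex hull misses a subspace lies strictly on the positive
side of some functional vanishing on the subspace. -/
theorem exists_functional_pos_of_disjoint_convexHull {V : Type*} [NormedAddCommGroup V]
    [NormedSpace ℝ V] [FiniteDimensional ℝ V] {A : Set V} (hA : A.Finite) (S : Submodule ℝ V)
    (hdisj : Disjoint (convexHull ℝ A) (S : Set V)) :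
    ∃ h : V →ₗ[ℝ] ℝ, (∀ w ∈ S, h w = 0) ∧ ∀ a ∈ A, 0 < h a := by
  obtain ⟨φ, s, t, hs, hst, ht⟩ := geometric_hahn_banach_compact_closed (convex_convexHull ℝ A)
    (hA.isCompact_convexHull ℝ) S.convex S.closed_of_finiteDimensional hdisj
  have h0 : ∀ w ∈ S, φ w = 0 := fun w hw => by
    by_contra hne
    have := ht ((t / φ w) • w) (S.smul_mem _ hw)
    rw [map_smul, smul_eq_mul, div_mul_cancel₀ _ hne] at this
    exact this.false
  refine ⟨-φ.toLinearMap, fun w hw => by simpa using h0 w hw, fun a ha => ?_⟩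
  have h1 := hs a (subset_convexHull ℝ A ha)
  have h2 := ht 0 S.zero_mem
  rw [map_zero] at h2
  simp only [LinearMap.neg_apply, ContinuousLinearMap.coe_coe]
  linarith

/-- If two distinct extreme points lie off a common facet of a configuration, then the configuration
has a cellular string with at least two blocks of total affine dimension at least `r - 1`. -/
theorem exists_large_cellularString {E : Type*} [Fintype E] {V : Type*} [NormedAddCommGroup V]
    [NormedSpace ℝ V] [FiniteDimensional ℝ V] (v : E → V) (π : V →ₗ[ℝ] ℝ) (hπ : ∀ e, π (v e) = 1)
    (f : V →ₗ[ℝ] ℝ) (hf : ∀ e, 0 ≤ f (v e))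
    (hfacet : Module.finrank ℝ (Submodule.span ℝ (Set.range v)) ≤
      Module.finrank ℝ (Submodule.span ℝ (v '' {e | f (v e) = 0})) + 1)
    {x y : E} (hxy : v x ≠ v y) (hx : v x ∈ (convexHull ℝ (Set.range v)).extremePoints ℝ)
    (hy : v y ∈ (convexHull ℝ (Set.range v)).extremePoints ℝ)
    (hfx : 0 < f (v x)) (hfy : 0 < f (v y)) :
    ∃ (l : ℕ) (b : E → Fin l), IsCellularString v l b ∧ 2 ≤ l ∧
      (Module.finrank ℝ (Submodule.span ℝ (Set.range v)) : ℤ) - 1 ≤ ∑ i : Fin l,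
        ((Module.finrank ℝ (Submodule.span ℝ (v '' {e | b e = i})) : ℤ) - 1) := by
  have hπP : ∀ p ∈ convexHull ℝ (Set.range v), π p = 1 := fun p hp =>
    convexHull_min (t := {p | π p = 1}) (by rintro _ ⟨e, rfl⟩; exact hπ e)
      (convex_hyperplane π.isLinear 1) hp
  obtain ⟨h, hh0, hhpos⟩ := exists_functional_pos_of_disjoint_convexHull
    (A := v '' {e | f (v e) = 0}) (Set.toFinite _) (Submodule.span ℝ {v x, v y})
    (Set.disjoint_left.2 fun w hw => notMem_span_pair_of_mem_extremePoints hπP hx hy hfx hfy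
      (convexHull_mono (Set.image_subset_range _ _) hw)
      (convexHull_min (t := {p | f p = 0}) (by rintro _ ⟨e, he, rfl⟩; exact he)
        (convex_hyperplane f.isLinear 0) hw))
  obtain ⟨M, hg⟩ := exists_pos_smul_add v f h hf fun e he => hhpos _ ⟨e, he, rfl⟩
  obtain ⟨l, b, hb, hbq⟩ := exists_isCellularString_of_ratio v f (M • f + h) hg
  have hpair : LinearIndependent ℝ ![v x, v y] := by
    rw [LinearIndependent.pair_iff]
    intro s t hst
    have h1 : s + t = 0 := by simpa [hπ] using congrArg π hst
    obtain rfl : t = -s := by linarith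
    have h2 : s • (v x - v y) = 0 := by rw [smul_sub, ← hst, neg_smul, sub_eq_add_neg]
    have := (smul_eq_zero.1 h2).resolve_right (sub_ne_zero.2 hxy)
    simp [this]
  have hpair_le : ∀ S : Submodule ℝ V, v x ∈ S → v y ∈ S → 2 ≤ Module.finrank ℝ S := by
    intro S hxS hyS
    have := finrank_span_eq_card hpair
    rw [Fintype.card_fin] at this
    refine this.ge.trans (Submodule.finrank_mono (Submodule.span_le.2 ?_))
    rintro _ ⟨i, rfl⟩
    fin_cases i <;> assumption
  have hr2 : 2 ≤ Module.finrank ℝ (Submodule.span ℝ (Set.range v)) :=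
    hpair_le _ (Submodule.subset_span ⟨x, rfl⟩) (Submodule.subset_span ⟨y, rfl⟩)
  obtain ⟨z, hz⟩ : ∃ z, f (v z) = 0 := by
    by_contra! hne
    have : {e | f (v e) = 0} = ∅ := by simpa [Set.eq_empty_iff_forall_notMem] using hne
    rw [this, Set.image_empty, Submodule.span_empty, finrank_bot] at hfacet
    omega
  have hbxy : b x = b y := by
    have hhx : h (v x) = 0 := hh0 _ (Submodule.subset_span (by simp))
    have hhy : h (v y) = 0 := hh0 _ (Submodule.subset_span (by simp))
    rw [hbq]
    simp only [LinearMap.add_apply, LinearMap.smul_apply, smul_eq_mul, hhx, hhy, add_zero]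
    rw [div_mul_cancel_right₀ hfx.ne', div_mul_cancel_right₀ hfy.ne']
  have hbzx : b z ≠ b x := fun heq => by
    rw [hbq, hz, zero_div] at heq
    exact (div_pos hfx (hg x)).ne heq
  have hnonneg : ∀ i, (0 : ℤ) ≤
      (Module.finrank ℝ (Submodule.span ℝ (v '' {e | b e = i})) : ℤ) - 1 := by
    intro i
    obtain ⟨e, he⟩ := hb.1 i
    have hne : v e ≠ 0 := fun h0 => by simpa [h0] using hπ e
    have := Submodule.finrank_mono (Submodule.span_mono (R := ℝ)
      (Set.singleton_subset_iff.2 (Set.mem_image_of_mem v (show e ∈ {e | b e = i} from he))))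
    rw [finrank_span_singleton hne] at this
    omega
  have hz_block : Module.finrank ℝ (Submodule.span ℝ (v '' {e | f (v e) = 0})) ≤
      Module.finrank ℝ (Submodule.span ℝ (v '' {e | b e = b z})) := by
    refine Submodule.finrank_mono (Submodule.span_mono (Set.image_mono fun e he => ?_))
    have he : f (v e) = 0 := he
    simp [hbq, he, hz]
  have hx_block : 2 ≤ Module.finrank ℝ (Submodule.span ℝ (v '' {e | b e = b x})) :=
    hpair_le _ (Submodule.subset_span ⟨x, rfl, rfl⟩) (Submodule.subset_span ⟨y, hbxy.symm, rfl⟩)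
  refine ⟨l, b, hb, ?_, ?_⟩
  · have := Fintype.card_le_of_injective ![b z, b x] (by
      intro i j hij
      fin_cases i <;> fin_cases j <;> simp_all [hbzx.symm])
    simpa using this
  · have hsum := sum_le_univ_sum_of_nonneg (s := {b z, b x}) hnonneg
    rw [sum_pair hbzx] at hsum
    omega

/-- If `(v, π)` is a configuration with `π(v e) = 1` for all `e`, `v`
injective, and there is no cellular string `(E_1, …, E_l)` with `l ≥ 2` and
`∑ (dim span E_i − 1) ≥ r − 1` where `r = dim span {v e}`, then the convex hull of the
points `v e` is a simplex: its extreme points are affinely independent. -/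
theorem statement15 {E : Type*} [Fintype E] {d : ℕ}
    (v : E → Fin d → ℝ) (π : (Fin d → ℝ) →ₗ[ℝ] ℝ)
    (hπ : ∀ e, π (v e) = 1)
    (hinj : Function.Injective v)
    (r : ℕ) (hr : r = Module.finrank ℝ (Submodule.span ℝ (Set.range v)))
    (hstr : ¬ ∃ (l : ℕ) (b : E → Fin l), IsCellularString v l b ∧ 2 ≤ l ∧
      (r : ℤ) - 1 ≤ ∑ i : Fin l,
        ((Module.finrank ℝ (Submodule.span ℝ (v '' {e | b e = i})) : ℤ) - 1)) :
    AffineIndependent ℝ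
      ((↑) : (convexHull ℝ (Set.range v)).extremePoints ℝ → (Fin d → ℝ)) := by
  have hspan : ∀ p ∈ (convexHull ℝ (Set.range v)).extremePoints ℝ, ∃ e, v e = p :=
    fun _ hp => Set.mem_range.1 (extremePoints_convexHull_subset hp)
  refine LinearIndependent.affineIndependent_of_module (linearIndependent_iff'.2 ?_)
  rintro s w hw ⟨p, hp⟩ hps
  obtain ⟨x, rfl⟩ := hspan p hp
  obtain ⟨f, hf, hfx, hfacet⟩ :=
    exists_facet_functional v π (fun e => by simp [hπ]) x (by simp [hπ])
  have hvanish : ∀ q ∈ (convexHull ℝ (Set.range v)).extremePoints ℝ, q ≠ v x → f q = 0 := by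
    intro q hq hne
    obtain ⟨y, rfl⟩ := hspan q hq
    by_contra hfy
    subst hr
    exact hstr (exists_large_cellularString v π hπ f hf hfacet hne.symm hp hq hfx
      ((hf y).lt_of_ne' hfy))
  have hfw := congrArg f hw
  rw [map_sum, map_zero, sum_eq_single_of_mem _ hps fun q _ hq => by
    rw [map_smul, hvanish q q.2 fun h => hq (Subtype.ext h), smul_zero], map_smul,
    smul_eq_mul] at hfw
  exact (mul_eq_zero.1 hfw).resolve_right hfx.ne'
end
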